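/- arXiv:2104.06741 — 2 statements merged into one kernel-verified Lean document; each statement's English description precedes it below -/
import Mathlib

section
/- Fix a prime p, natural numbers n, m ≥ 1, and polynomials f_1,…,f_n, g_1,…,g_n ∈ ℤ[x_1,…,x_m]. Let A_p = 𝔽̄_p[t^{1/p^∞}]/(t^{p−1}). Then there exists x ∈ (ℤ^ab/pℤ^ab)^m with f_i(x) = 0 and g_i(x) ≠ 0 for all 1 ≤ i ≤ n, if and only if there exist m-tuples x_1,…,x_n ∈ A_p^m such that f_i(x_j) = 0 for all 1 ≤ i, j ≤ n and g_i(x_i) ≠ 0 for all 1 ≤ i ≤ n. -/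
noncomputable section

/-- The ring of abelian algebraic integers `ℤ^ab`: the subring of a fixed algebraic
closure of `ℚ` generated by all roots of unity. -/
noncomputable def Zab : Subring (AlgebraicClosure ℚ) :=
  Subring.closure {x : AlgebraicClosure ℚ | ∃ n : ℕ, 0 < n ∧ x ^ n = 1}

/-- The quotient `ℤ^ab / p ℤ^ab`. -/
noncomputable abbrev ZabMod (p : ℕ) : Type :=
  Zab ⧸ Ideal.span {(p : Zab)}

/-- The ring hom `R[X]/(X^a) →+* R[X]/(X^b)` induced by `X ↦ X^k`, well defined when
`b ≤ a * k`. -/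
noncomputable def powQuotMap (R : Type*) [CommRing R] (a b k : ℕ) (h : b ≤ a * k) :
    (Polynomial R ⧸ Ideal.span {(Polynomial.X : Polynomial R) ^ a}) →+*
      (Polynomial R ⧸ Ideal.span {(Polynomial.X : Polynomial R) ^ b}) :=
  Ideal.Quotient.lift _
    ((Ideal.Quotient.mk _).comp (Polynomial.eval₂RingHom Polynomial.C (Polynomial.X ^ k)))
    (fun f hf => by
      rw [Ideal.mem_span_singleton] at hf
      obtain ⟨g, rfl⟩ := hf
      simp only [RingHom.comp_apply, Polynomial.coe_eval₂RingHom, Polynomial.eval₂_mul,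
        Polynomial.eval₂_pow, Polynomial.eval₂_X]
      rw [← pow_mul, Ideal.Quotient.eq_zero_iff_mem]
      exact Ideal.mul_mem_right _ _
        (Ideal.mem_span_singleton.2 (pow_dvd_pow _ (le_trans h (le_of_eq (mul_comm a k))))))

/-- `R[t^{1/p^∞}]/(t^{p-1})`: the direct limit over `n : ℕ` of the rings
`R[X]/(X^{p^n(p-1)})`, with transition maps induced by `X ↦ X^p`
(from stage `n` to stage `m` the map is induced by `X ↦ X^{p^{m-n}}`). -/
noncomputable abbrev PerfQuot (R : Type*) [CommRing R] (p : ℕ) : Type _ :=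
  Ring.DirectLimit
    (fun n : ℕ => Polynomial R ⧸ Ideal.span {(Polynomial.X : Polynomial R) ^ (p ^ n * (p - 1))})
    (fun n m hnm => powQuotMap R (p ^ n * (p - 1)) (p ^ m * (p - 1)) (p ^ (m - n))
      (le_of_eq (by rw [mul_right_comm, ← pow_add, Nat.add_sub_cancel' hnm])))

open Polynomial

theorem hom_mvaeval {A B : Type*} [CommRing A] [CommRing B] [Algebra ℤ A] [Algebra ℤ B] (ψ : A →+* B) {σ : Type*}
    (x : σ → A) (F : MvPolynomial σ ℤ) :
    ψ (MvPolynomial.aeval x F) = MvPolynomial.aeval (fun i => ψ (x i)) F := by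
  let ψ' : A →ₐ[ℤ] B := { ψ with
    commutes' := fun r => by
      rw [eq_intCast (algebraMap ℤ A), eq_intCast (algebraMap ℤ B)]
      exact map_intCast ψ r }
  have := MvPolynomial.comp_aeval_apply (R := ℤ) (f := x) ψ' F
  exact this

/-- substitution `X ↦ ω (1 + X)`. -/
def subst (p : ℕ) [hp : Fact p.Prime] (K : Type*) [Field K] [Algebra (ZMod p) K] (ω : K) :
    (ZMod p)[X] →+* K[X] :=
  eval₂RingHom (C.comp (algebraMap (ZMod p) K)) (C ω * (1 + X))

theorem subst_eq (p : ℕ) [hp : Fact p.Prime] (K : Type*) [Field K] [Algebra (ZMod p) K] (ω : K) (h : (ZMod p)[X]) :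
    subst p K ω h = (h.map (algebraMap _ K)).comp (C ω * (1 + X)) := by
  simp [subst, comp, eval₂_map]

theorem subst_dvd_iff (p : ℕ) [hp : Fact p.Prime] (K : Type*) [Field K] [Algebra (ZMod p) K] (ω : K) (hω : ω ≠ 0)
    (h : (ZMod p)[X]) (e : ℕ) :
    X ^ e ∣ subst p K ω h ↔ (X - C ω) ^ e ∣ h.map (algebraMap _ K) := by
  rw [subst_eq]
  set H := h.map (algebraMap _ K)
  have hc : (C ω : K[X]) * C ω⁻¹ = 1 := by
    rw [← C_mul, mul_inv_cancel₀ hω, C_1]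
  constructor
  · rintro ⟨u, hu⟩
    have := congrArg (fun q => q.comp (C ω⁻¹ * X - 1)) hu
    simp only [comp_assoc, mul_comp, C_comp, add_comp, one_comp, X_comp, pow_comp] at this
    have h1 : (C ω : K[X]) * (1 + (C ω⁻¹ * X - 1)) = X := by
      linear_combination X * hc
    rw [h1, comp_X] at this
    rw [this]
    refine Dvd.dvd.mul_right (pow_dvd_pow_of_dvd ⟨C ω⁻¹, ?_⟩ e) _
    linear_combination hc
  · rintro ⟨u, hu⟩
    rw [hu]
    simp only [mul_comp, pow_comp, sub_comp, X_comp, C_comp]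
    refine Dvd.dvd.mul_right (pow_dvd_pow_of_dvd ⟨C ω, ?_⟩ e) _
    ring

theorem cyc_dvd_iff (p : ℕ) [hp : Fact p.Prime] (K : Type*) [Field K] [Algebra (ZMod p) K] [IsAlgClosed K] (N : ℕ) (hN : ¬ p ∣ N) (h : (ZMod p)[X]) (e : ℕ) :
    cyclotomic N (ZMod p) ^ e ∣ h ↔
      ∀ ω : K, IsPrimitiveRoot ω N → X ^ e ∣ subst p K ω h := by
  have hN0 : 0 < N := Nat.pos_of_ne_zero (by rintro rfl; simp at hN)
  have : CharP K p := charP_of_injective_algebraMap (algebraMap (ZMod p) K).injective p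
  have : NeZero (N : K) :=
    ⟨fun h0 => hN ((CharP.cast_eq_zero_iff K p N).1 h0)⟩
  have : NeZero N := ⟨hN0.ne'⟩
  obtain ⟨ζ, hζ⟩ := HasEnoughRootsOfUnity.exists_primitiveRoot K N
  rw [← map_dvd_map' (algebraMap (ZMod p) K), Polynomial.map_pow, map_cyclotomic,
    cyclotomic_eq_prod_X_sub_primitiveRoots hζ, ← Finset.prod_pow]
  constructor
  · intro hd ω hω
    rw [subst_dvd_iff p K ω (hω.ne_zero hN0.ne')]
    exact (Finset.dvd_prod_of_mem (fun x : K => (X - C x) ^ e) ((mem_primitiveRoots hN0).2 hω)).trans hd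
  · intro hd
    refine Finset.prod_dvd_of_coprime ?_ ?_
    · intro a _ b _ hab
      exact (pairwise_coprime_X_sub_C Function.injective_id hab).pow
    · intro ω hω
      have hω := (mem_primitiveRoots hN0).1 hω
      rw [← subst_dvd_iff p K ω (hω.ne_zero hN0.ne')]
      exact hd ω hω

/-- evaluation at `t^{1/p^k}`. -/
def evk (p : ℕ) [_hp : Fact p.Prime] (K : Type*) [Field K] (k : ℕ) :
    K[X] →+* PerfQuot K p :=
  (Ring.DirectLimit.of
    (fun n : ℕ => K[X] ⧸ Ideal.span {(X : K[X]) ^ (p ^ n * (p - 1))})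
    (fun n m hnm => powQuotMap K (p ^ n * (p - 1)) (p ^ m * (p - 1)) (p ^ (m - n))
      (le_of_eq (by rw [mul_right_comm, ← pow_add, Nat.add_sub_cancel' hnm]))) k).comp
    (Ideal.Quotient.mk _)

theorem powQuotMap_mk (R : Type*) [CommRing R] (a b k : ℕ) (h : b ≤ a * k) (q : R[X]) :
    powQuotMap R a b k h (Ideal.Quotient.mk _ q) = Ideal.Quotient.mk _ (expand R k q) := by
  rw [powQuotMap, Ideal.Quotient.lift_mk]
  rfl

theorem expand_dvd {R : Type*} [CommRing R] (a k : ℕ) (hk : 0 < k) (q : R[X])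
    (h : X ^ (a * k) ∣ expand R k q) : X ^ a ∣ q := by
  rw [X_pow_dvd_iff] at h ⊢
  intro d hd
  rw [← coeff_expand_mul hk q d]
  exact h _ (by gcongr)

theorem evk_zero_iff (p : ℕ) [hp : Fact p.Prime] (K : Type*) [Field K] (k : ℕ) (a : K[X]) :
    evk p K k a = 0 ↔ X ^ (p ^ k * (p - 1)) ∣ a := by
  constructor
  · intro h
    rw [evk, RingHom.comp_apply] at h
    have : DirectedSystem (fun n : ℕ => K[X] ⧸ Ideal.span {(X : K[X]) ^ (p ^ n * (p - 1))})
      (fun n m hnm => powQuotMap K (p ^ n * (p - 1)) (p ^ m * (p - 1)) (p ^ (m - n))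
      (le_of_eq (by rw [mul_right_comm, ← pow_add, Nat.add_sub_cancel' hnm]))) := by
      constructor
      · intro i x
        obtain ⟨x, rfl⟩ := Ideal.Quotient.mk_surjective x
        rw [powQuotMap_mk]
        simp
      · intro l j i hij hjl x
        obtain ⟨x, rfl⟩ := Ideal.Quotient.mk_surjective x
        rw [powQuotMap_mk, powQuotMap_mk, powQuotMap_mk, expand_expand, ← pow_add]
        have : l - j + (j - i) = l - i := by omega
        simp only [this]
    obtain ⟨j, hj, h0⟩ := Ring.DirectLimit.of.zero_exact h
    rw [powQuotMap_mk, Ideal.Quotient.eq_zero_iff_mem, Ideal.mem_span_singleton] at h0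
    refine expand_dvd _ (p ^ (j - k)) (pow_pos hp.out.pos _) _ ?_
    convert h0 using 2
    rw [mul_right_comm, ← pow_add, Nat.add_sub_cancel' hj]
  · intro h
    rw [evk, RingHom.comp_apply, Ideal.Quotient.eq_zero_iff_mem.2 (Ideal.mem_span_singleton.2 h), map_zero]

theorem evk_surj (p : ℕ) [hp : Fact p.Prime] (K : Type*) [Field K] (z : PerfQuot K p) :
    ∃ k, ∀ k', k ≤ k' → ∃ a, evk p K k' a = z := by
  obtain ⟨k, x, rfl⟩ := Ring.DirectLimit.exists_of z
  obtain ⟨x, rfl⟩ := Ideal.Quotient.mk_surjective x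
  refine ⟨k, fun k' hk => ⟨expand _ (p ^ (k' - k)) x, ?_⟩⟩
  rw [evk, RingHom.comp_apply, ← powQuotMap_mk _ (p ^ k * (p - 1)) _ _
    (le_of_eq (by rw [mul_right_comm, ← pow_add, Nat.add_sub_cancel' hk]))]
  exact Ring.DirectLimit.of_f (f := (fun n m hnm => powQuotMap K (p ^ n * (p - 1)) (p ^ m * (p - 1)) (p ^ (m - n))
      (le_of_eq (by rw [mul_right_comm, ← pow_add, Nat.add_sub_cancel' hnm])))) hk _

section generic
variable (L : Type*) [Field L]

/-- generic version of `Zab`. -/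
def Zg : Subring L := Subring.closure {x : L | ∃ n : ℕ, 0 < n ∧ x ^ n = 1}

/-- evaluation of an integer polynomial. -/
abbrev iev {A : Type*} [CommRing A] (x : A) : ℤ[X] →+* A := eval₂RingHom (Int.castRingHom A) x

theorem iev_eq_aeval {A : Type*} [CommRing A] (x : A) (h : ℤ[X]) : iev x h = aeval x h := rfl

theorem coeZg_iev (ζ : Zg L) (h : ℤ[X]) : ((iev ζ h : Zg L) : L) = iev (ζ : L) h :=
  (aeval_algHom_apply (R := ℤ) (Zg L).subtype.toIntAlgHom ζ h).symm

theorem Zg_integral (z : Zg L) : IsIntegral ℤ (z : L) := by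
  have : Zg L ≤ (integralClosure ℤ L).toSubring := by
    refine Subring.closure_le.2 ?_
    rintro x ⟨n, hn, hx⟩
    exact IsIntegral.of_pow hn (by rw [hx]; exact isIntegral_one)
  exact this z.2

theorem Zg_rep (z : L) (hz : z ∈ Zg L) :
    ∃ M : ℕ, 0 < M ∧ ∀ M', 0 < M' → M ∣ M' → ∀ ζ : L, IsPrimitiveRoot ζ M' →
      ∃ h : ℤ[X], iev ζ h = z := by
  induction hz using Subring.closure_induction with
  | mem x hx =>
    obtain ⟨n, hn, hx⟩ := hx
    refine ⟨n, hn, fun M' hM' hd ζ hζ => ?_⟩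
    have : NeZero M' := ⟨hM'.ne'⟩
    obtain ⟨i, _, hi⟩ := hζ.eq_pow_of_pow_eq_one (ξ := x) (by
      obtain ⟨c, rfl⟩ := hd
      rw [pow_mul, hx, one_pow])
    exact ⟨X ^ i, by simp [hi]⟩
  | zero => exact ⟨1, one_pos, fun _ _ _ _ _ => ⟨0, by simp⟩⟩
  | one => exact ⟨1, one_pos, fun _ _ _ _ _ => ⟨1, by simp⟩⟩
  | add x y _ _ hx hy =>
    obtain ⟨A, hA, hx⟩ := hx
    obtain ⟨B, hB, hy⟩ := hy
    refine ⟨A * B, Nat.mul_pos hA hB, fun M' hM' hd ζ hζ => ?_⟩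
    obtain ⟨u, hu⟩ := hx M' hM' (dvd_of_mul_right_dvd hd) ζ hζ
    obtain ⟨v, hv⟩ := hy M' hM' (dvd_of_mul_left_dvd hd) ζ hζ
    exact ⟨u + v, by rw [map_add, hu, hv]⟩
  | mul x y _ _ hx hy =>
    obtain ⟨A, hA, hx⟩ := hx
    obtain ⟨B, hB, hy⟩ := hy
    refine ⟨A * B, Nat.mul_pos hA hB, fun M' hM' hd ζ hζ => ?_⟩
    obtain ⟨u, hu⟩ := hx M' hM' (dvd_of_mul_right_dvd hd) ζ hζ
    obtain ⟨v, hv⟩ := hy M' hM' (dvd_of_mul_left_dvd hd) ζ hζ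
    exact ⟨u * v, by rw [map_mul, hu, hv]⟩
  | neg x _ hx =>
    obtain ⟨A, hA, hx⟩ := hx
    refine ⟨A, hA, fun M' hM' hd ζ hζ => ?_⟩
    obtain ⟨u, hu⟩ := hx M' hM' hd ζ hζ
    exact ⟨-u, by rw [map_neg, hu]⟩

variable [CharZero L] [Algebra.IsIntegral ℚ L]

theorem integral_rep (M : ℕ) [NeZero M] (ζ : L) (hζ : IsPrimitiveRoot ζ M)
    (z : L) (hz : IsIntegral ℤ z) (hz' : z ∈ IntermediateField.adjoin ℚ {ζ}) :
    ∃ h : ℤ[X], iev ζ h = z := by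
  let K := IntermediateField.adjoin ℚ {ζ}
  have : IsCyclotomicExtension {M} ℚ K := hζ.intermediateField_adjoin_isCyclotomicExtension ℚ
  have : NumberField K := IsCyclotomicExtension.numberField {M} ℚ K
  let ζ' : K := ⟨ζ, IntermediateField.mem_adjoin_simple_self ℚ ζ⟩
  have hζ' : IsPrimitiveRoot ζ' M := by
    refine IsPrimitiveRoot.of_map_of_injective (f := K.val) (by exact hζ) K.val.injective
  have h1 := IsCyclotomicExtension.Rat.isIntegralClosure_adjoin_singleton hζ'
  have h2 : IsIntegral ℤ (⟨z, hz'⟩ : K) := by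
    refine (isIntegral_algHom_iff (K.val.restrictScalars ℤ) (K.val.injective)).1 (by exact hz)
  obtain ⟨y, hy⟩ := h1.isIntegral_iff.1 h2
  obtain ⟨q, hq⟩ := (Algebra.adjoin_singleton_eq_range_aeval ℤ ζ').le y.2
  refine ⟨q, ?_⟩
  have h3 : aeval ζ' q = (⟨z, hz'⟩ : K) := hq.trans hy
  have h4 := congrArg (K.val.restrictScalars ℤ) h3
  rw [← aeval_algHom_apply] at h4
  exact h4

theorem zg_zero_iff (p : ℕ) [hp : Fact p.Prime] (N k : ℕ) (hN : ¬ p ∣ N) (ζ : Zg L)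
    (hζ : IsPrimitiveRoot (ζ : L) (p ^ (k + 1) * N)) (h : ℤ[X]) :
    (Ideal.Quotient.mk (Ideal.span {(p : Zg L)}) (iev ζ h) = 0) ↔
      cyclotomic N (ZMod p) ^ (p ^ k * (p - 1)) ∣ h.map (Int.castRingHom (ZMod p)) := by
  have hN0 : 0 < N := Nat.pos_of_ne_zero (by rintro rfl; simp at hN)
  have hM : 0 < p ^ (k + 1) * N := Nat.mul_pos (pow_pos hp.out.pos _) hN0
  have : NeZero (p ^ (k + 1) * N) := ⟨hM.ne'⟩
  have hcyc : (cyclotomic (p ^ (k + 1) * N) ℤ).map (Int.castRingHom (ZMod p)) =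
      cyclotomic N (ZMod p) ^ (p ^ k * (p - 1)) := by
    rw [map_cyclotomic, cyclotomic_mul_prime_pow_eq _ hN (Nat.succ_pos k), Nat.succ_eq_add_one,
      Nat.add_sub_cancel, pow_succ, Nat.mul_sub, mul_one]
  rw [← hcyc, Ideal.Quotient.eq_zero_iff_mem, Ideal.mem_span_singleton]
  constructor
  · rintro ⟨z, hz⟩
    have hz1 := congrArg (fun x : Zg L => (x : L)) hz
    simp only [coeZg_iev] at hz1
    push_cast at hz1
    have hp0 : (p : L) ≠ 0 := by exact_mod_cast hp.out.ne_zero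
    obtain ⟨v, hv⟩ := integral_rep L _ (ζ : L) hζ z (Zg_integral L z) (by
      have : (z : L) = iev (ζ : L) h / p := by
        rw [hz1]; field_simp
      rw [this]
      refine div_mem ?_ (by exact natCast_mem _ p)
      rw [coe_eval₂RingHom, eval₂_eq_sum_range]
      refine sum_mem fun i _ => mul_mem (by simp) (pow_mem (IntermediateField.mem_adjoin_simple_self ℚ _) _))
    have h0 : aeval (ζ : L) (h - (p : ℤ[X]) * v) = 0 := by
      rw [← iev_eq_aeval, map_sub, map_mul, hv, hz1, map_natCast, sub_self]
    have hd := minpoly.isIntegrallyClosed_dvd (Zg_integral L ζ) h0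
    rw [← cyclotomic_eq_minpoly hζ hM] at hd
    have := Polynomial.map_dvd (Int.castRingHom (ZMod p)) hd
    simpa using this
  · rintro ⟨u, hu⟩
    obtain ⟨U, rfl⟩ := Polynomial.map_surjective (Int.castRingHom (ZMod p)) (ZMod.ringHom_surjective _) u
    have h0 : (h - cyclotomic (p ^ (k + 1) * N) ℤ * U).map (Int.castRingHom (ZMod p)) = 0 := by
      simp only [Polynomial.map_sub, Polynomial.map_mul, hu, sub_self]
    have h1 : C (p : ℤ) ∣ h - cyclotomic (p ^ (k + 1) * N) ℤ * U := by
      rw [C_dvd_iff_dvd_coeff]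
      intro i
      have := congrArg (fun q => coeff q i) h0
      simp only [coeff_map, coeff_zero] at this
      exact (ZMod.intCast_zmod_eq_zero_iff_dvd _ p).1 this
    obtain ⟨v, hv⟩ := h1
    have h2 : h = cyclotomic (p ^ (k + 1) * N) ℤ * U + C (p : ℤ) * v := by
      rw [← hv]; ring
    refine ⟨iev ζ v, ?_⟩
    have h3 : iev ζ (cyclotomic (p ^ (k + 1) * N) ℤ) = 0 := by
      apply Subtype.ext
      rw [coeZg_iev, cyclotomic_eq_minpoly hζ hM]
      exact minpoly.aeval _ _
    rw [h2, map_add, map_mul, h3, zero_mul, zero_add, map_mul]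
    simp

end generic

theorem totient_bound (N : ℕ) :
    (Odd N → N ≤ N.totient ^ 2) ∧ N ≤ 2 * N.totient ^ 2 := by
  induction N using Nat.recOnPosPrimePosCoprime with
  | prime_pow q s hq hs =>
    obtain ⟨s, rfl⟩ : ∃ t, s = t + 1 := ⟨s - 1, by omega⟩
    rw [Nat.totient_prime_pow_succ hq]
    have hpos : 1 ≤ q ^ s := Nat.one_le_pow _ _ hq.pos
    rcases hq.eq_two_or_odd' with rfl | ho
    · constructor
      · intro h
        exact absurd h (by simp [Nat.odd_pow_iff])
      · rw [pow_succ]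
        nlinarith
    · have h3 : 3 ≤ q := by
        have := hq.two_le
        rcases ho with ⟨t, rfl⟩
        omega
      obtain ⟨r, rfl⟩ : ∃ r, q = r + 3 := ⟨q - 3, by omega⟩
      have key : (r + 3) ^ (s + 1) ≤ ((r + 3) ^ s * (r + 3 - 1)) ^ 2 := by
        have : r + 3 - 1 = r + 2 := by omega
        rw [this, mul_pow, pow_succ]
        have h1 : (r + 3) ^ s ≤ ((r + 3) ^ s) ^ 2 := by nlinarith
        have h2 : r + 3 ≤ (r + 2) ^ 2 := by nlinarith
        exact Nat.mul_le_mul h1 h2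
      exact ⟨fun _ => key, by omega⟩
  | zero => simp
  | one => simp
  | coprime a b _ _ hab ha hb =>
    rw [Nat.totient_mul hab]
    constructor
    · intro h
      rw [Nat.odd_mul] at h
      rw [mul_pow]
      exact Nat.mul_le_mul (ha.1 h.1) (hb.1 h.2)
    · rcases Nat.even_or_odd a with h | h
      · have hbo : Odd b := by
          by_contra h'
          rw [Nat.not_odd_iff_even] at h'
          have := Nat.dvd_gcd h.two_dvd h'.two_dvd
          rw [hab] at this
          omega
        have := Nat.mul_le_mul ha.2 (hb.1 hbo)
        rw [mul_pow]
        linarith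
      · have := Nat.mul_le_mul (ha.1 h) hb.2
        rw [mul_pow]
        linarith

theorem exists_D (p : ℕ) [hp : Fact p.Prime] (n d : ℕ) (hd : 0 < d) :
    ∃ D, 0 < D ∧ d ∣ D ∧ n * D ≤ (p ^ D - 1).totient := by
  have h1 := (tendsto_pow_const_div_const_pow_of_one_lt 3 (r := 2) (by norm_num)).eventually
    (gt_mem_nhds (zero_lt_one))
  obtain ⟨B, hB⟩ := Filter.eventually_atTop.1 h1
  set D := d * (B + 2 * n ^ 2 + 1) with hD
  have hDge : B + 2 * n ^ 2 + 1 ≤ D := Nat.le_mul_of_pos_left _ hd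
  refine ⟨D, by omega, ⟨_, rfl⟩, ?_⟩
  have h2 := hB D (by omega)
  rw [div_lt_one (by positivity)] at h2
  have h3 : D ^ 3 < 2 ^ D := by exact_mod_cast h2
  have h4 : 2 ^ D ≤ p ^ D := Nat.pow_le_pow_left hp.out.two_le D
  have h5 := (totient_bound (p ^ D - 1)).2
  have h6 : 2 * (n * D) ^ 2 ≤ p ^ D - 1 := by
    have : (2 * n ^ 2) * D ^ 2 ≤ D * D ^ 2 := Nat.mul_le_mul_right _ (by omega)
    have : 2 * (n * D) ^ 2 ≤ D ^ 3 := by nlinarith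
    omega
  have h7 : (n * D) ^ 2 ≤ (p ^ D - 1).totient ^ 2 := by omega
  exact (Nat.pow_le_pow_iff_left two_ne_zero).1 h7

theorem not_dvd_N (p : ℕ) [hp : Fact p.Prime] (D : ℕ) (hD : 0 < D) : ¬ p ∣ p ^ D - 1 := by
  intro h
  have h1 : p ∣ p ^ D := dvd_pow_self p hD.ne'
  have h2 : 1 ≤ p ^ D := Nat.one_le_pow _ _ hp.out.pos
  have := (Nat.dvd_sub_iff_right h2 h1).1 h
  exact hp.out.one_lt.ne' (Nat.dvd_one.1 this)

open UniqueFactorizationMonoid in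
theorem card_factors (p : ℕ) [hp : Fact p.Prime] (n D : ℕ) (hD : 0 < D)
    (h : n * D ≤ (p ^ D - 1).totient) :
    n ≤ (normalizedFactors (cyclotomic (p ^ D - 1) (ZMod p))).toFinset.card := by
  have hc : p.Coprime (p ^ D - 1) := (Nat.Prime.coprime_iff_not_dvd hp.out).2 (not_dvd_N p D hD)
  have h2 : 1 ≤ p ^ D := Nat.one_le_pow _ _ hp.out.pos
  rw [normalizedFactors_cyclotomic_card (K := ZMod p) (p := p) (f := 1) (by simp) hc]
  have ho : orderOf (ZMod.unitOfCoprime _ (hc.pow_left 1)) ≤ D := by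
    refine orderOf_le_of_pow_eq_one hD ?_
    ext
    simp only [Units.val_pow_eq_pow_val, ZMod.coe_unitOfCoprime, Units.val_one, pow_one]
    have : ((p ^ D - 1 : ℕ) : ZMod (p ^ D - 1)) = 0 := ZMod.natCast_self _
    rw [Nat.cast_sub h2] at this
    push_cast at this
    exact sub_eq_zero.1 this
  have hpos : 0 < p ^ D - 1 := by
    have : 2 ≤ p ^ D := hp.out.two_le.trans (Nat.le_self_pow hD.ne' p)
    omega
  have : NeZero (p ^ D - 1) := ⟨hpos.ne'⟩
  rw [Nat.le_div_iff_mul_le (orderOf_pos _)]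
  exact (Nat.mul_le_mul_left _ ho).trans h

theorem alg_pow (p : ℕ) [hp : Fact p.Prime] (K : Type*) [Field K] [Algebra (ZMod p) K]
    [Algebra.IsAlgebraic (ZMod p) K] (a : K) :
    ∃ d, 0 < d ∧ ∀ c, d ∣ c → a ^ p ^ c = a := by
  let F := IntermediateField.adjoin (ZMod p) {a}
  have : FiniteDimensional (ZMod p) F :=
    IntermediateField.adjoin.finiteDimensional (Algebra.IsIntegral.isIntegral a)
  have : Finite F := Module.finite_of_finite (ZMod p)
  have := Fintype.ofFinite F
  refine ⟨Module.finrank (ZMod p) F, Module.finrank_pos, ?_⟩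
  rintro _ ⟨r, rfl⟩
  have h := FiniteField.pow_card_pow (K := F) r
    ⟨a, IntermediateField.mem_adjoin_simple_self _ a⟩
  rw [Module.card_eq_pow_finrank (K := ZMod p), ZMod.card, ← pow_mul] at h
  exact congrArg Subtype.val h

theorem alg_pow_poly (p : ℕ) [hp : Fact p.Prime] (K : Type*) [Field K] [Algebra (ZMod p) K]
    [Algebra.IsAlgebraic (ZMod p) K] (a : K[X]) :
    ∃ d, 0 < d ∧ ∀ c, d ∣ c → ∀ i, (a.coeff i) ^ p ^ c = a.coeff i := by
  choose d hd h using alg_pow p K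
  refine ⟨∏ i ∈ a.support, d (a.coeff i), Finset.prod_pos fun i _ => hd _, fun c hc i => ?_⟩
  by_cases hi : i ∈ a.support
  · exact h _ _ ((Finset.dvd_prod_of_mem (fun i => d (a.coeff i)) hi).trans hc)
  · rw [notMem_support_iff.1 hi]
    exact zero_pow (pow_pos hp.out.pos _).ne'

theorem alg_pow_fam (p : ℕ) [hp : Fact p.Prime] (K : Type*) [Field K] [Algebra (ZMod p) K]
    [Algebra.IsAlgebraic (ZMod p) K] {ι : Type*} [Fintype ι] (a : ι → K[X]) :
    ∃ d, 0 < d ∧ ∀ c, d ∣ c → ∀ j i, ((a j).coeff i) ^ p ^ c = (a j).coeff i := by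
  choose d hd h using fun j => alg_pow_poly p K (a j)
  exact ⟨∏ j, d j, Finset.prod_pos fun i _ => hd _, fun c hc j i =>
    h j c ((Finset.dvd_prod_of_mem d (Finset.mem_univ j)).trans hc) i⟩

theorem subst_X (p : ℕ) [hp : Fact p.Prime] (K : Type*) [Field K] [Algebra (ZMod p) K] (ω : K) :
    subst p K ω X = C ω * (1 + X) := by
  simp [subst]

theorem fill (p : ℕ) [hp : Fact p.Prime] (K : Type*) [Field K] [Algebra (ZMod p) K] (D : ℕ)
    (hD : 0 < D) (ω : K) (hω : IsPrimitiveRoot ω (p ^ D - 1)) (k : ℕ) (a : K[X])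
    (ha : ∀ i, (a.coeff i) ^ p ^ D = a.coeff i) :
    ∃ h : (ZMod p)[X], evk p K k (subst p K ω h) = evk p K k a := by
  have : CharP K p := charP_of_injective_algebraMap (algebraMap (ZMod p) K).injective p
  have h2 : 2 ≤ p ^ D := hp.out.two_le.trans (Nat.le_self_pow hD.ne' p)
  obtain ⟨N, hN⟩ : ∃ N, p ^ D = N + 2 := ⟨p ^ D - 2, by omega⟩
  have hN1 : p ^ D - 1 = N + 1 := by omega
  have hω1 : ω ^ (N + 1) = 1 := by rw [← hN1]; exact hω.pow_eq_one
  let S := ((evk p K k).comp (subst p K ω)).range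
  suffices hS : evk p K k a ∈ S by
    obtain ⟨h, hh⟩ := hS
    exact ⟨h, hh⟩
  set e := p ^ k * (p - 1) with he
  have hfix : ∀ s, ω ^ (p ^ D) ^ s = ω := by
    intro s
    induction s with
    | zero => simp
    | succ s ih => rw [pow_succ, pow_mul, ih, hN, pow_succ, hω1, one_mul]
  have hCω : evk p K k (C ω) ∈ S := by
    refine ⟨X ^ (p ^ D) ^ e, ?_⟩
    rw [RingHom.comp_apply, map_pow, subst_X, mul_pow, ← C_pow, hfix]
    have : CharP K[X] p := inferInstance
    have h3 : ((1 : K[X]) + X) ^ (p ^ D) ^ e = 1 + X ^ (p ^ D) ^ e := by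
      rw [← pow_mul, add_pow_char_pow, one_pow]
    rw [h3, ← sub_eq_zero, ← map_sub, evk_zero_iff]
    have h4 : C ω * (1 + X ^ (p ^ D) ^ e) - C ω = C ω * X ^ (p ^ D) ^ e := by ring
    rw [h4]
    refine Dvd.dvd.mul_left (pow_dvd_pow _ ?_) _
    rw [← he]
    exact (Nat.lt_pow_self (by omega)).le
  have hX : evk p K k X ∈ S := by
    have h5 : evk p K k (C ω * (1 + X)) ∈ S := ⟨X, by rw [RingHom.comp_apply, subst_X]⟩
    have h6 : (X : K[X]) = C ω ^ N * (C ω * (1 + X)) - 1 := by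
      rw [← mul_assoc, ← pow_succ, ← C_pow, hω1, C_1]
      ring
    have h7 := congrArg (evk p K k) h6
    rw [map_sub, map_mul, map_pow, map_one] at h7
    rw [h7]
    exact sub_mem (mul_mem (pow_mem hCω _) h5) (one_mem _)
  rw [a.as_sum_range_C_mul_X_pow, map_sum]
  refine sum_mem fun i _ => ?_
  rw [map_mul, map_pow]
  refine mul_mem ?_ (pow_mem hX _)
  by_cases h0 : a.coeff i = 0
  · rw [h0, C_0, map_zero]
    exact zero_mem _
  · have : NeZero (p ^ D - 1) := ⟨by omega⟩
    obtain ⟨s, _, hs⟩ := hω.eq_pow_of_pow_eq_one (ξ := a.coeff i) (by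
      refine mul_left_cancel₀ h0 ?_
      rw [mul_one, ← pow_succ']
      have : p ^ D - 1 + 1 = p ^ D := by omega
      rw [this]
      exact ha i)
    rw [← hs, C_pow, map_pow]
    exact pow_mem hCω _

theorem subst_conj (p : ℕ) [hp : Fact p.Prime] (K : Type*) [Field K] [Algebra (ZMod p) K]
    (σ : K →ₐ[ZMod p] K) (ω : K) (h : (ZMod p)[X]) :
    subst p K (σ ω) h = (subst p K ω h).map (σ : K →+* K) := by
  rw [subst_eq, subst_eq, map_comp, Polynomial.map_map]
  simp

theorem map_X_dvd {K : Type*} [Field K] (σ : K →+* K) (e : ℕ) (q : K[X]) (h : X ^ e ∣ q) :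
    X ^ e ∣ q.map σ := by
  have := Polynomial.map_dvd σ h
  simpa using this

theorem subst_dvd_of_root (p : ℕ) [hp : Fact p.Prime] (K : Type*) [Field K] [Algebra (ZMod p) K]
    (ω : K) (P h : (ZMod p)[X]) (e : ℕ) (hP : aeval ω P = 0) (hd : P ^ e ∣ h) :
    X ^ e ∣ subst p K ω h := by
  have h1 : X ∣ subst p K ω P := by
    rw [X_dvd_iff, coeff_zero_eq_eval_zero, subst_eq, eval_comp]
    simpa [aeval_def, eval_map] using hP
  obtain ⟨u, rfl⟩ := hd
  rw [map_mul, map_pow]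
  exact Dvd.dvd.mul_right (pow_dvd_pow_of_dvd h1 e) _

/-- The key comparison. -/
theorem key_iff (L : Type*) [Field L] [CharZero L] [Algebra.IsIntegral ℚ L]
    (p : ℕ) [hp : Fact p.Prime] (K : Type*) [Field K] [Algebra (ZMod p) K] [IsAlgClosed K]
    (N k : ℕ) (hN : ¬ p ∣ N) (ζ : Zg L)
    (hζ : IsPrimitiveRoot (ζ : L) (p ^ (k + 1) * N)) {m : ℕ} (R : Fin m → ℤ[X])
    (F : MvPolynomial (Fin m) ℤ) :
    MvPolynomial.aeval (fun l => Ideal.Quotient.mk (Ideal.span {(p : Zg L)}) (iev ζ (R l))) F = 0 ↔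
      ∀ ω : K, IsPrimitiveRoot ω N → MvPolynomial.aeval
        (fun l => evk p K k (subst p K ω ((R l).map (Int.castRingHom (ZMod p))))) F = 0 := by
  have h1 := hom_mvaeval ((Ideal.Quotient.mk (Ideal.span {(p : Zg L)})).comp (iev ζ)) R F
  simp only [RingHom.comp_apply] at h1
  rw [← h1, zg_zero_iff L p N k hN ζ hζ, cyc_dvd_iff p K N hN]
  refine forall_congr' fun ω => imp_congr_right fun _ => ?_
  have h2 := hom_mvaeval ((evk p K k).comp ((subst p K ω).comp
    (mapRingHom (Int.castRingHom (ZMod p))))) R F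
  simp only [RingHom.comp_apply, coe_mapRingHom] at h2
  rw [← h2, evk_zero_iff]

theorem forward_dir (L : Type*) [Field L] [CharZero L] [Algebra.IsIntegral ℚ L] [IsAlgClosed L]
    (p : ℕ) [hp : Fact p.Prime] (K : Type*) [Field K] [Algebra (ZMod p) K] [IsAlgClosed K]
    (n m : ℕ) (f g : Fin n → MvPolynomial (Fin m) ℤ)
    (x : Fin m → Zg L ⧸ Ideal.span {(p : Zg L)})
    (hf : ∀ i, MvPolynomial.aeval x (f i) = 0) (hg : ∀ i, MvPolynomial.aeval x (g i) ≠ 0) :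
    ∃ x : Fin n → Fin m → PerfQuot K p,
        (∀ i j : Fin n, MvPolynomial.aeval (x j) (f i) = 0) ∧
        (∀ i : Fin n, MvPolynomial.aeval (x i) (g i) ≠ 0) := by
  choose z hz using fun l => Ideal.Quotient.mk_surjective (x l)
  choose M hM hrep using fun l => Zg_rep L (z l) (z l).2
  set M₀ := p * ∏ l, M l with hM₀
  have hM₀pos : 0 < M₀ := Nat.mul_pos hp.out.pos (Finset.prod_pos fun l _ => hM l)
  obtain ⟨s, N, hN, hs⟩ := Nat.exists_eq_pow_mul_and_not_dvd hM₀pos.ne' p hp.out.ne_one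
  obtain ⟨k, rfl⟩ : ∃ k, s = k + 1 := by
    rcases s with _ | k
    · exfalso
      rw [pow_zero, one_mul] at hs
      exact hN (hs ▸ ⟨_, hM₀⟩)
    · exact ⟨k, rfl⟩
  have : NeZero M₀ := ⟨hM₀pos.ne'⟩
  have : NeZero (M₀ : L) := ⟨by exact_mod_cast hM₀pos.ne'⟩
  obtain ⟨ζ, hζ⟩ := HasEnoughRootsOfUnity.exists_primitiveRoot L M₀
  let ζ' : Zg L := ⟨ζ, Subring.subset_closure ⟨M₀, hM₀pos, hζ.pow_eq_one⟩⟩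
  choose R hR using fun l => hrep l M₀ hM₀pos
    ((Finset.dvd_prod_of_mem M (Finset.mem_univ l)).trans (Dvd.intro_left _ rfl)) ζ hζ
  have hx : x = fun l => Ideal.Quotient.mk (Ideal.span {(p : Zg L)}) (iev ζ' (R l)) := by
    funext l
    rw [← hz l]
    congr 1
    apply Subtype.ext
    rw [coeZg_iev]
    exact (hR l).symm
  have key := key_iff L p K N k hN ζ' (hs ▸ hζ) R
  rw [← hx] at key
  have hg' : ∀ i, ∃ ω : K, IsPrimitiveRoot ω N ∧ MvPolynomial.aeval
        (fun l => evk p K k (subst p K ω ((R l).map (Int.castRingHom (ZMod p))))) (g i) ≠ 0 := by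
    intro i
    have := hg i
    rw [Ne, key] at this
    push Not at this
    exact this
  choose ω hω hω' using hg'
  exact ⟨fun j l => evk p K k (subst p K (ω j) ((R l).map (Int.castRingHom (ZMod p)))),
    fun i j => (key (f i)).1 (hf i) (ω j) (hω j), hω'⟩

open UniqueFactorizationMonoid in
theorem backward_dir (L : Type*) [Field L] [CharZero L] [Algebra.IsIntegral ℚ L] [IsAlgClosed L]
    (p : ℕ) [hp : Fact p.Prime] (K : Type*) [Field K] [Algebra (ZMod p) K] [IsAlgClosed K]
    [Algebra.IsAlgebraic (ZMod p) K]
    (n m : ℕ) (hn : 1 ≤ n) (f g : Fin n → MvPolynomial (Fin m) ℤ)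
    (x : Fin n → Fin m → PerfQuot K p)
    (hf : ∀ i j : Fin n, MvPolynomial.aeval (x j) (f i) = 0)
    (hg : ∀ i : Fin n, MvPolynomial.aeval (x i) (g i) ≠ 0) :
    ∃ x : Fin m → Zg L ⧸ Ideal.span {(p : Zg L)}, ∀ i : Fin n,
        MvPolynomial.aeval x (f i) = 0 ∧ MvPolynomial.aeval x (g i) ≠ 0 := by
  classical
  have : CharP K p := charP_of_injective_algebraMap (algebraMap (ZMod p) K).injective p
  choose k₀ hk₀ using fun j l => evk_surj p K (x j l)
  obtain ⟨k, hk⟩ : ∃ k, ∀ j l, k₀ j l ≤ k :=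
    ⟨∑ j, ∑ l, k₀ j l, fun j l =>
      (Finset.single_le_sum (f := fun l => k₀ j l) (fun _ _ => Nat.zero_le _)
        (Finset.mem_univ l)).trans
      (Finset.single_le_sum (f := fun j => ∑ l, k₀ j l) (fun _ _ => Nat.zero_le _)
        (Finset.mem_univ j))⟩
  choose a ha using fun j l => hk₀ j l k (hk j l)
  obtain ⟨d, hd, hda⟩ := alg_pow_fam p K (fun jl : Fin n × Fin m => a jl.1 jl.2)
  obtain ⟨D, hD, hdD, hcard⟩ := exists_D p n d hd
  have hN := not_dvd_N p D hD
  have hfac := card_factors p n D hD hcard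
  set N := p ^ D - 1 with hNdef
  have hN0 : 0 < N := Nat.pos_of_ne_zero (by intro h; rw [h] at hN; simp at hN)
  have : NeZero (N : K) := ⟨fun h0 => hN ((CharP.cast_eq_zero_iff K p N).1 h0)⟩
  let ι := {P // P ∈ (normalizedFactors (cyclotomic N (ZMod p))).toFinset}
  have hmem : ∀ P : ι, P.1 ∈ normalizedFactors (cyclotomic N (ZMod p)) :=
    fun P => Multiset.mem_toFinset.1 P.2
  have hirr : ∀ P : ι, Irreducible P.1 := fun P => irreducible_of_normalized_factor _ (hmem P)
  obtain ⟨emb⟩ : Nonempty (Fin n ↪ ι) := by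
    refine Function.Embedding.nonempty_of_card_le ?_
    rw [Fintype.card_fin, Fintype.card_coe]
    exact hfac
  have : Nonempty (Fin n) := ⟨⟨0, hn⟩⟩
  let c : ι → Fin n := Function.invFun emb
  have hc : ∀ j, c (emb j) = j := Function.leftInverse_invFun emb.injective
  choose w hw using fun P : ι => IsAlgClosed.exists_aeval_eq_zero K P.1
    (Polynomial.degree_pos_of_irreducible (hirr P)).ne'
  have hwprim : ∀ P, IsPrimitiveRoot (w P) N := by
    intro P
    rw [← isRoot_cyclotomic_iff, ← map_cyclotomic N (algebraMap (ZMod p) K), IsRoot.def, eval_map,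
      ← aeval_def]
    obtain ⟨u, hu⟩ := dvd_of_mem_normalizedFactors (hmem P)
    rw [hu, map_mul, hw, zero_mul]
  choose h hh using fun (P : ι) (l : Fin m) => fill p K D hD (w P) (hwprim P) k (a (c P) l)
    (hda D hdD (c P, l))
  set e := p ^ k * (p - 1) with he
  have hcop : Pairwise (Function.onFun IsCoprime (fun P : ι => Ideal.span {P.1 ^ e})) := by
    intro P Q hPQ
    rw [Function.onFun, Ideal.isCoprime_span_singleton_iff]
    refine IsCoprime.pow ?_
    rw [(hirr P).coprime_iff_not_dvd]
    intro hdv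
    have has := (hirr P).associated_of_dvd (hirr Q) hdv
    apply hPQ
    apply Subtype.ext
    rw [← normalize_normalized_factor _ (hmem P), ← normalize_normalized_factor _ (hmem Q)]
    exact normalize_eq_normalize_iff_associated.2 has
  choose r hr using fun l => Ideal.exists_forall_sub_mem_ideal hcop (fun P => h P l)
  choose R hR using fun l => Polynomial.map_surjective (Int.castRingHom (ZMod p))
    (ZMod.ringHom_surjective _) (r l)
  have hMpos : 0 < p ^ (k + 1) * N := Nat.mul_pos (pow_pos hp.out.pos _) hN0
  have : NeZero (p ^ (k + 1) * N) := ⟨hMpos.ne'⟩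
  have : NeZero ((p ^ (k + 1) * N : ℕ) : L) := ⟨by exact_mod_cast hMpos.ne'⟩
  obtain ⟨ζ, hζ⟩ := HasEnoughRootsOfUnity.exists_primitiveRoot L (p ^ (k + 1) * N)
  let ζ' : Zg L := ⟨ζ, Subring.subset_closure ⟨_, hMpos, hζ.pow_eq_one⟩⟩
  have key := key_iff L p K N k hN ζ' hζ R
  have hcong : ∀ (ω : K) (P : ι), aeval ω P.1 = 0 → ∀ l,
      evk p K k (subst p K ω (r l)) = evk p K k (subst p K ω (h P l)) := by
    intro ω P hP l
    rw [← sub_eq_zero, ← map_sub, ← map_sub, evk_zero_iff]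
    exact subst_dvd_of_root p K ω P.1 _ _ hP (Ideal.mem_span_singleton.1 (hr l P))
  have hval : ∀ (P : ι) l, evk p K k (subst p K (w P) (h P l)) = x (c P) l := by
    intro P l
    rw [hh, ha]
  refine ⟨fun l => Ideal.Quotient.mk (Ideal.span {(p : Zg L)}) (iev ζ' (R l)), fun i => ⟨?_, ?_⟩⟩
  · rw [key]
    intro ω hω
    simp only [hR]
    have hint : IsIntegral (ZMod p) ω := Algebra.IsIntegral.isIntegral ω
    have hmin : minpoly (ZMod p) ω ∣ cyclotomic N (ZMod p) := by
      refine minpoly.dvd _ _ ?_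
      rw [aeval_def, ← eval_map, map_cyclotomic]
      exact isRoot_cyclotomic_iff.2 hω
    obtain ⟨q, hq, hqa⟩ := exists_mem_normalizedFactors_of_dvd (cyclotomic_ne_zero N (ZMod p))
      (minpoly.irreducible hint) hmin
    let P : ι := ⟨q, Multiset.mem_toFinset.2 hq⟩
    have hPω : aeval ω P.1 = 0 := by
      obtain ⟨u, hu⟩ := hqa.dvd
      change aeval ω q = 0
      rw [hu, map_mul, minpoly.aeval, zero_mul]
    obtain ⟨σ, hσ⟩ : ∃ σ : K →ₐ[ZMod p] K, σ (w P) = ω := by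
      refine IntermediateField.exists_algHom_of_splits_of_aeval
        (fun s => ⟨Algebra.IsIntegral.isIntegral s, IsAlgClosed.splits _⟩) ?_
      have h1 : minpoly (ZMod p) (w P) ∣ P.1 := minpoly.dvd _ _ (hw P)
      have h2 := (minpoly.irreducible
        (Algebra.IsIntegral.isIntegral (R := ZMod p) (w P))).associated_of_dvd (hirr P) h1
      obtain ⟨u, hu⟩ := h2.symm.dvd
      rw [hu, map_mul, hPω, zero_mul]
    simp only [hcong ω P hPω]
    have h3 := fun ω' : K => hom_mvaeval ((evk p K k).comp (subst p K ω')) (h P) (f i)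
    simp only [RingHom.comp_apply] at h3
    have h4 := h3 (w P)
    simp only [hval] at h4
    rw [hf i (c P), evk_zero_iff] at h4
    rw [← h3 ω, evk_zero_iff, ← hσ, subst_conj]
    exact map_X_dvd _ _ _ h4
  · rw [Ne, key]
    intro hall
    have h5 := hall (w (emb i)) (hwprim _)
    simp only [hR, hcong _ _ (hw (emb i)), hval, hc] at h5
    exact hg i h5

theorem isIntegral_rat_closure :
    @Algebra.IsIntegral ℚ (AlgebraicClosure ℚ) _ _ DivisionRing.toRatAlgebra := by
  have h : Algebra.IsAlgebraic ℚ (AlgebraicClosure ℚ) := AlgebraicClosure.isAlgebraic ℚ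
  have h2 := h.isIntegral
  convert h2

/-- Fix a prime `p`, `n, m ≥ 1` and integer polynomials `f i, g i`.
Let `A_p = 𝔽̄_p[t^{1/p^∞}]/(t^{p-1})`. The system `f i = 0, g i ≠ 0` is solvable in
`ℤ^ab/pℤ^ab` iff there are `m`-tuples `x 1, …, x n` over `A_p` with `f i (x j) = 0` for
all `i, j` and `g i (x i) ≠ 0` for all `i`. -/
theorem stmt3 (p : ℕ) [hp : Fact p.Prime] (n m : ℕ) (hn : 1 ≤ n) (hm : 1 ≤ m)
    (f g : Fin n → MvPolynomial (Fin m) ℤ) :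
    (∃ x : Fin m → ZabMod p, ∀ i : Fin n,
        MvPolynomial.aeval x (f i) = 0 ∧ MvPolynomial.aeval x (g i) ≠ 0) ↔
    (∃ x : Fin n → Fin m → PerfQuot (AlgebraicClosure (ZMod p)) p,
        (∀ i j : Fin n, MvPolynomial.aeval (x j) (f i) = 0) ∧
        (∀ i : Fin n, MvPolynomial.aeval (x i) (g i) ≠ 0)) := by
  have := isIntegral_rat_closure
  constructor
  · rintro ⟨x, hx⟩
    exact forward_dir (AlgebraicClosure ℚ) p (AlgebraicClosure (ZMod p)) n m f g x
      (fun i => (hx i).1) (fun i => (hx i).2)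
  · rintro ⟨x, hf, hg⟩
    exact backward_dir (AlgebraicClosure ℚ) p (AlgebraicClosure (ZMod p)) n m hn f g x hf hg

end
end

section
/- Fix a prime p and let A_p = 𝔽̄_p[t^{1/p^∞}]/(t^{p−1}). Then the rings ℤ^ab/pℤ^ab and the countable power (A_p)^ℕ are existentially equivalent in the language of rings: for all m, n ∈ ℕ and all polynomials f_1,…,f_n, g_1,…,g_n ∈ ℤ[x_1,…,x_m], the system f_1(x) = … = f_n(x) = 0, g_1(x) ≠ 0, …, g_n(x) ≠ 0 has a solution in (ℤ^ab/pℤ^ab)^m if and only if it has a solution in ((A_p)^ℕ)^m. -/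
noncomputable section

lemma tot_odd (m : ℕ) : Odd m → m ≤ m.totient ^ 2 := by
  induction m using Nat.recOnPosPrimePosCoprime with
  | prime_pow q k hq hk =>
    intro ho
    have h3 : 3 ≤ q := by
      have h2 := hq.two_le
      rcases Nat.lt_or_ge 2 q with h | h
      · exact h
      · have : q = 2 := by omega
        subst this
        rw [Nat.odd_pow_iff hk.ne'] at ho
        exact absurd ho (by decide)
    rw [Nat.totient_prime_pow hq hk]
    obtain ⟨k, rfl⟩ : ∃ j, k = j + 1 := ⟨k - 1, by omega⟩
    obtain ⟨q, rfl⟩ : ∃ j, q = j + 1 := ⟨q - 1, by omega⟩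
    simp only [Nat.add_sub_cancel]
    rw [mul_pow, pow_succ]
    have h1 : 1 ≤ (q+1)^k := Nat.one_le_pow _ _ (by omega)
    have h2 : q + 1 ≤ q ^ 2 := by nlinarith
    exact Nat.mul_le_mul (by nlinarith) h2
  | zero => simp
  | one => simp
  | coprime a b ha hb hab iha ihb =>
    intro ho
    rw [Nat.odd_mul] at ho
    rw [Nat.totient_mul hab, mul_pow]
    exact Nat.mul_le_mul (iha ho.1) (ihb ho.2)

lemma tot_bound (m : ℕ) (hm : m ≠ 0) : m ≤ 2 * m.totient ^ 2 := by
  obtain ⟨k, n, hn, rfl⟩ := Nat.exists_eq_two_pow_mul_odd hm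
  have := tot_odd n hn
  rw [Nat.totient_mul (Nat.Coprime.pow_left _ (Nat.coprime_two_left.2 hn))]
  rcases Nat.eq_zero_or_pos k with rfl | hk
  · simp; omega
  · rw [Nat.totient_prime_pow Nat.prime_two hk]
    obtain ⟨k, rfl⟩ : ∃ j, k = j + 1 := ⟨k - 1, by omega⟩
    have h1 : 1 ≤ 2^k := Nat.one_le_pow _ _ (by omega)
    simp only [Nat.add_sub_cancel]
    calc 2^(k+1) * n = 2 * (2^k * n) := by ring
      _ ≤ 2 * ((2^k)^2 * n.totient^2) := by
        exact Nat.mul_le_mul_left _ (Nat.mul_le_mul (by nlinarith) this)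
      _ = _ := by ring

lemma exists_r (p d n : ℕ) (hp : p.Prime) (hd : 0 < d) :
    ∃ r, 1 < r ∧ d ∣ r ∧ n * r ≤ (p ^ r - 1).totient := by
  have h := tendsto_pow_const_div_const_pow_of_one_lt 2 (r := (2:ℝ)) (by norm_num)
  have h1 := h.eventually (gt_mem_nhds (show (0:ℝ) < 1 / (2 * n^2 + 2) by positivity))
  obtain ⟨N, hN⟩ := Filter.eventually_atTop.1 h1
  refine ⟨d * (N + 2), by nlinarith, dvd_mul_right _ _, ?_⟩
  have h2 := hN (d * (N+2)) (by nlinarith)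
  generalize hr : d * (N + 2) = r at *
  have hr1 : 1 < r := by nlinarith
  rw [div_lt_div_iff₀ (by positivity) (by positivity)] at h2
  have h3 : r ^ 2 * (2 * n^2 + 2) < 2 ^ r := by
    have : ((r ^ 2 * (2 * n^2 + 2) : ℕ) : ℝ) < (2 ^ r : ℕ) := by push_cast; linarith
    exact_mod_cast this
  have h4 : 2 ^ r ≤ p ^ r := Nat.pow_le_pow_left hp.two_le _
  have h5 := tot_bound (p ^ r - 1) (by nlinarith [Nat.sub_add_cancel (show 1 ≤ p^r by nlinarith)])
  by_contra! hc
  have h6 : p ^ r ≤ 2 * (p ^ r - 1).totient ^ 2 + 1 := by omega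
  have h7 : (p ^ r - 1).totient ^ 2 ≤ (n * r)^2 := Nat.pow_le_pow_left hc.le _
  nlinarith

lemma order_r (p r : ℕ) (hp : p.Prime) (hr : 1 < r) (h : (p^1).Coprime (p ^ r - 1)) :
    orderOf (ZMod.unitOfCoprime _ h) = r := by
  have hpr : 1 ≤ p ^ r := Nat.one_le_pow _ _ hp.pos
  have key : ∀ j, (ZMod.unitOfCoprime _ h) ^ j = 1 ↔ (p^r - 1) ∣ p ^ j - 1 := by
    intro j
    rw [Units.ext_iff, ← Nat.modEq_iff_dvd' (Nat.one_le_pow _ _ hp.pos), ← ZMod.natCast_eq_natCast_iff]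
    simp [eq_comm]
  rw [orderOf_eq_iff (by omega)]
  refine ⟨(key r).2 dvd_rfl, fun j hj h0 => ?_⟩
  rw [Ne, key]
  intro hd
  have := Nat.le_of_dvd (Nat.sub_pos_of_lt (Nat.one_lt_pow h0.ne' hp.one_lt)) hd
  have h8 : p ^ j < p ^ r := Nat.pow_lt_pow_right hp.one_lt hj
  exact (Nat.sub_lt_sub_right (Nat.one_le_pow _ _ hp.pos) h8).not_ge this
open Polynomial in
lemma powQuotMap_inj (R : Type*) [CommRing R] (a b k : ℕ) (h : b ≤ a * k) (h' : a * k ≤ b)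
    (hk : 0 < k) : Function.Injective (powQuotMap R a b k h) := by
  rw [injective_iff_map_eq_zero]
  intro x
  obtain ⟨x, rfl⟩ := Ideal.Quotient.mk_surjective x
  intro hx
  have h1 : powQuotMap R a b k h (Ideal.Quotient.mk _ x)
    = Ideal.Quotient.mk _ (Polynomial.expand R k x) := rfl
  rw [h1, Ideal.Quotient.eq_zero_iff_mem, Ideal.mem_span_singleton, X_pow_dvd_iff] at hx
  rw [Ideal.Quotient.eq_zero_iff_mem, Ideal.mem_span_singleton, X_pow_dvd_iff]
  intro d hd
  have := hx (d * k) (lt_of_lt_of_le (Nat.mul_lt_mul_of_pos_right hd hk) h')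
  rwa [coeff_expand_mul hk] at this

/-- the canonical map from polynomials (stage `k`) to `PerfQuot`. -/
def thetaMap (R : Type*) [CommRing R] (p k : ℕ) : Polynomial R →+* PerfQuot R p :=
  (Ring.DirectLimit.of
    (fun n : ℕ => Polynomial R ⧸ Ideal.span {(Polynomial.X : Polynomial R) ^ (p ^ n * (p - 1))})
    (fun n m hnm => powQuotMap R (p ^ n * (p - 1)) (p ^ m * (p - 1)) (p ^ (m - n))
      (le_of_eq (by rw [mul_right_comm, ← pow_add, Nat.add_sub_cancel' hnm]))) k).comp
    (Ideal.Quotient.mk _)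

open Polynomial in
lemma theta_sys (R : Type*) [CommRing R] (p : ℕ) : DirectedSystem
    (fun n : ℕ => Polynomial R ⧸ Ideal.span {(Polynomial.X : Polynomial R) ^ (p ^ n * (p - 1))})
    (fun n m hnm => powQuotMap R (p ^ n * (p - 1)) (p ^ m * (p - 1)) (p ^ (m - n))
      (le_of_eq (by rw [mul_right_comm, ← pow_add, Nat.add_sub_cancel' hnm]))) where
  map_self i x := by
    obtain ⟨x, rfl⟩ := Ideal.Quotient.mk_surjective x
    change Ideal.Quotient.mk _ (Polynomial.expand R (p ^ (i - i)) x) = _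
    simp
  map_map k j i hij hjk x := by
    obtain ⟨x, rfl⟩ := Ideal.Quotient.mk_surjective x
    change Ideal.Quotient.mk (Ideal.span {(X : Polynomial R) ^ (p ^ k * (p - 1))})
        (Polynomial.expand R (p ^ (k - j)) (Polynomial.expand R (p ^ (j - i)) x))
      = Ideal.Quotient.mk (Ideal.span {(X : Polynomial R) ^ (p ^ k * (p - 1))}) (Polynomial.expand R (p ^ (k - i)) x)
    rw [Polynomial.expand_expand, ← pow_add]
    congr 4
    omega

lemma theta_eq_zero (R : Type*) [CommRing R] (p k : ℕ) (hp : p.Prime) (x : Polynomial R) :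
    thetaMap R p k x = 0 ↔ Polynomial.X ^ (p ^ k * (p - 1)) ∣ x := by
  have := theta_sys R p
  have hinj := Ring.DirectLimit.of_injective (G := (fun n : ℕ => Polynomial R ⧸ Ideal.span {(Polynomial.X : Polynomial R) ^ (p ^ n * (p - 1))}))
    (fun n m hnm => powQuotMap R (p ^ n * (p - 1)) (p ^ m * (p - 1)) (p ^ (m - n))
      (le_of_eq (by rw [mul_right_comm, ← pow_add, Nat.add_sub_cancel' hnm])))
    (fun i j hij => powQuotMap_inj _ _ _ _ _
      (le_of_eq (by rw [mul_right_comm, ← pow_add, Nat.add_sub_cancel' hij])) (pow_pos hp.pos _)) k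
  rw [← Ideal.mem_span_singleton, ← Ideal.Quotient.eq_zero_iff_mem]
  exact map_eq_zero_iff _ hinj

lemma theta_step (R : Type*) [CommRing R] (p k l : ℕ) (h : k ≤ l) (x : Polynomial R) :
    thetaMap R p k x = thetaMap R p l (Polynomial.expand R (p ^ (l - k)) x) :=
  (Ring.DirectLimit.of_f (G := (fun n : ℕ => Polynomial R ⧸ Ideal.span {(Polynomial.X : Polynomial R) ^ (p ^ n * (p - 1))}))
    (f := fun n m hnm => powQuotMap R (p ^ n * (p - 1)) (p ^ m * (p - 1)) (p ^ (m - n))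
      (le_of_eq (by rw [mul_right_comm, ← pow_add, Nat.add_sub_cancel' hnm])))
      h (Ideal.Quotient.mk _ x)).symm

lemma theta_lift {ι : Type*} [Finite ι] (R : Type*) [CommRing R] (p : ℕ) (y : ι → PerfQuot R p) :
    ∃ k, ∃ Y : ι → Polynomial R, ∀ i, thetaMap R p k (Y i) = y i := by
  have h1 : ∀ i, ∃ k, ∃ Y, thetaMap R p k Y = y i := by
    intro i
    obtain ⟨k, x, hx⟩ := Ring.DirectLimit.exists_of (y i)
    obtain ⟨x, rfl⟩ := Ideal.Quotient.mk_surjective x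
    exact ⟨k, x, hx⟩
  choose k Y hY using h1
  obtain ⟨l, hl⟩ := Finite.bddAbove_range k
  refine ⟨l, fun i => Polynomial.expand R (p ^ (l - k i)) (Y i), fun i => ?_⟩
  rw [← theta_step _ _ _ _ (hl ⟨i, rfl⟩), hY]

/-- evaluation of integer polynomials at an element of `Zab`, modulo `p`. -/
def xiMap (p : ℕ) (z : Zab) : Polynomial ℤ →+* ZabMod p :=
  (Ideal.Quotient.mk _).comp (Polynomial.aeval z).toRingHom

lemma Zab_root {ζ : AlgebraicClosure ℚ} {N : ℕ} (hN : 0 < N) (h : ζ ^ N = 1) : ζ ∈ Zab :=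
  Subring.subset_closure ⟨N, hN, h⟩

lemma Zab_integral (x : AlgebraicClosure ℚ) (hx : x ∈ Zab) : IsIntegral ℤ x := by
  have : Zab ≤ (integralClosure ℤ (AlgebraicClosure ℚ)).toSubring := by
    refine Subring.closure_le.2 ?_
    rintro y ⟨n, hn, hy⟩
    exact IsIntegral.of_pow hn (by rw [hy]; exact isIntegral_one)
  exact this hx

lemma Zab_mem_adjoin (x : AlgebraicClosure ℚ) (hx : x ∈ Zab) : ∃ N, 0 < N ∧ ∀ M, 0 < M → N ∣ M →
    ∀ ζ : AlgebraicClosure ℚ, IsPrimitiveRoot ζ M → x ∈ Algebra.adjoin ℤ {ζ} := by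
  induction hx using Subring.closure_induction with
  | mem x hx =>
    obtain ⟨n, hn, hx⟩ := hx
    refine ⟨n, hn, fun M hM hd ζ hζ => ?_⟩
    have hx' : x ^ M = 1 := by
      obtain ⟨c, rfl⟩ := hd
      rw [pow_mul, hx, one_pow]
    have : NeZero M := ⟨hM.ne'⟩
    obtain ⟨i, -, rfl⟩ := hζ.eq_pow_of_pow_eq_one hx'
    exact pow_mem (Algebra.self_mem_adjoin_singleton _ _) _
  | zero => exact ⟨1, one_pos, fun _ _ _ _ _ => zero_mem _⟩
  | one => exact ⟨1, one_pos, fun _ _ _ _ _ => one_mem _⟩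
  | add x y _ _ hx hy =>
    obtain ⟨a, ha, hx⟩ := hx
    obtain ⟨b, hb, hy⟩ := hy
    exact ⟨a * b, Nat.mul_pos ha hb, fun M hM hd ζ hζ =>
      add_mem (hx M hM (dvd_trans (dvd_mul_right _ _) hd) ζ hζ)
        (hy M hM (dvd_trans (dvd_mul_left _ _) hd) ζ hζ)⟩
  | mul x y _ _ hx hy =>
    obtain ⟨a, ha, hx⟩ := hx
    obtain ⟨b, hb, hy⟩ := hy
    exact ⟨a * b, Nat.mul_pos ha hb, fun M hM hd ζ hζ =>
      mul_mem (hx M hM (dvd_trans (dvd_mul_right _ _) hd) ζ hζ)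
        (hy M hM (dvd_trans (dvd_mul_left _ _) hd) ζ hζ)⟩
  | neg x _ hx =>
    obtain ⟨a, ha, hx⟩ := hx
    exact ⟨a, ha, fun M hM hd ζ hζ => neg_mem (hx M hM hd ζ hζ)⟩

lemma exists_prim (N : ℕ) (hN : 0 < N) :
    ∃ ζ : Zab, IsPrimitiveRoot (ζ : AlgebraicClosure ℚ) N := by
  have : NeZero N := ⟨hN.ne'⟩
  obtain ⟨ζ, hζ⟩ := HasEnoughRootsOfUnity.exists_primitiveRoot (AlgebraicClosure ℚ) N
  exact ⟨⟨ζ, Zab_root hN hζ.pow_eq_one⟩, hζ⟩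

lemma coe_aeval_Zab (z : Zab) (h : Polynomial ℤ) :
    ((Polynomial.aeval z h : Zab) : AlgebraicClosure ℚ) = Polynomial.aeval (z : AlgebraicClosure ℚ) h := by
  rw [Polynomial.aeval_def, Polynomial.aeval_def]
  exact (Polynomial.hom_eval₂ h _ Zab.subtype z).trans (by congr 1)

lemma xi_lift {ι : Type*} [Finite ι] (p : ℕ) (hp : p.Prime) (y : ι → ZabMod p) :
    ∃ m k : ℕ, ¬ p ∣ m ∧ ∃ z : Zab, IsPrimitiveRoot (z : AlgebraicClosure ℚ) (p ^ (k + 1) * m) ∧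
      ∃ Y : ι → Polynomial ℤ, ∀ i, xiMap p z (Y i) = y i := by
  have := Fintype.ofFinite ι
  choose x hx using fun i => Ideal.Quotient.mk_surjective (y i)
  choose N hN h using fun i => Zab_mem_adjoin (x i) (x i).2
  have hM : 0 < p * ∏ i, N i := Nat.mul_pos hp.pos (Finset.prod_pos fun i _ => hN i)
  obtain ⟨k, m, hm, hk⟩ := Nat.exists_eq_pow_mul_and_not_dvd hM.ne' p hp.ne_one
  obtain ⟨z, hz⟩ := exists_prim _ hM
  have hk0 : k ≠ 0 := by
    rintro rfl
    rw [pow_zero, one_mul] at hk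
    exact hm ⟨_, hk.symm⟩
  obtain ⟨k, rfl⟩ := Nat.exists_eq_succ_of_ne_zero hk0
  refine ⟨m, k, hm, z, hk ▸ hz, ?_⟩
  have h' := fun i => h i _ hM (dvd_mul_of_dvd_right (Finset.dvd_prod_of_mem N (Finset.mem_univ i)) _) z hz
  simp only [Algebra.adjoin_singleton_eq_range_aeval] at h'
  choose Y hY using h'
  refine ⟨Y, fun i => ?_⟩
  rw [← hx i]
  change Ideal.Quotient.mk _ (Polynomial.aeval z (Y i)) = _
  congr 1
  apply Subtype.ext
  rw [coe_aeval_Zab]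
  exact hY i

open Polynomial in
lemma xi_eq_zero (p : ℕ) [hp : Fact p.Prime] (N : ℕ) (hN : 0 < N) (z : Zab)
    (hz : IsPrimitiveRoot (z : AlgebraicClosure ℚ) N) (h : ℤ[X]) :
    xiMap p z h = 0 ↔ cyclotomic N (ZMod p) ∣ h.map (Int.castRingHom (ZMod p)) := by
  have hNe : NeZero N := ⟨hN.ne'⟩
  change Ideal.Quotient.mk _ (Polynomial.aeval z h) = 0 ↔ _
  rw [Ideal.Quotient.eq_zero_iff_mem, Ideal.mem_span_singleton]
  have hmin := cyclotomic_eq_minpoly hz hN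
  constructor
  · rintro ⟨w, hw⟩
    have hw' := congrArg (Subtype.val) hw
    rw [coe_aeval_Zab] at hw'
    set ζ : AlgebraicClosure ℚ := (z : AlgebraicClosure ℚ) with hζ
    let K := IntermediateField.adjoin ℚ {ζ}
    have hζK : ζ ∈ K := IntermediateField.mem_adjoin_simple_self ℚ ζ
    let ζK : K := ⟨ζ, hζK⟩
    have halg : Algebra.IsAlgebraic ℚ (AlgebraicClosure ℚ) := by
      refine ⟨fun x => ?_⟩
      obtain ⟨q, hq, hx⟩ := (AlgebraicClosure.isAlgebraic ℚ).1 x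
      refine ⟨q, hq, ?_⟩
      rw [aeval_def] at hx ⊢
      rw [← hx]
      congr 1
    have hcyc : IsCyclotomicExtension {N} ℚ K :=
      hz.intermediateField_adjoin_isCyclotomicExtension ℚ
    have hzK : IsPrimitiveRoot ζK N := IsPrimitiveRoot.coe_submonoidClass_iff.1 hz
    have hIC := IsCyclotomicExtension.Rat.isIntegralClosure_adjoin_singleton (K := K) hzK
    have hp0 : (p : AlgebraicClosure ℚ) ≠ 0 := Nat.cast_ne_zero.2 hp.out.ne_zero
    have hwv : (w : AlgebraicClosure ℚ) = ((aeval ζK h / p : K) : AlgebraicClosure ℚ) := by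
      have : ((aeval ζK h : K) : AlgebraicClosure ℚ) = aeval ζ h := by
        exact (aeval_algebraMap_apply (AlgebraicClosure ℚ) ζK h).symm
      push_cast
      rw [this, hw', eq_div_iff hp0]
      push_cast
      ring
    have hInt : IsIntegral ℤ (aeval ζK h / p : K) := by
      have := Zab_integral w w.2
      rw [hwv] at this
      exact (isIntegral_algebraMap_iff (FaithfulSMul.algebraMap_injective K (AlgebraicClosure ℚ))).1 this
    obtain ⟨v, hv⟩ := hIC.isIntegral_iff.1 hInt
    obtain ⟨v, hv2⟩ := v
    obtain ⟨u, hu⟩ : v ∈ (aeval (R := ℤ) ζK).range := by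
      rw [← Algebra.adjoin_singleton_eq_range_aeval]
      exact hv2
    have huK : aeval ζK u = aeval ζK h / p := hu.trans (by exact hv)
    have hpK : (p : K) ≠ 0 := Nat.cast_ne_zero.2 hp.out.ne_zero
    have h0 : aeval ζ (h - C (p : ℤ) * u) = 0 := by
      have : aeval ζK (h - C (p : ℤ) * u) = 0 := by
        simp [huK]
        field_simp
        simp
      have h2 := aeval_algebraMap_apply (AlgebraicClosure ℚ) ζK (h - C (p : ℤ) * u)
      rw [this, map_zero] at h2
      exact h2
    have hd := minpoly.isIntegrallyClosed_dvd (hz.isIntegral hN) h0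
    rw [← hmin] at hd
    have := map_dvd (mapRingHom (Int.castRingHom (ZMod p))) hd
    simpa using this
  · rintro ⟨u, hu⟩
    obtain ⟨u, rfl⟩ := map_surjective (Int.castRingHom (ZMod p)) (ZMod.intCast_surjective) u
    have h0 : (h - cyclotomic N ℤ * u).map (Int.castRingHom (ZMod p)) = 0 := by
      simp [hu]
    have h1 : C (p : ℤ) ∣ h - cyclotomic N ℤ * u := by
      rw [C_dvd_iff_dvd_coeff]
      intro i
      have := congrArg (fun q => q.coeff i) h0
      simp only [coeff_map, coeff_zero] at this
      exact (ZMod.intCast_zmod_eq_zero_iff_dvd _ p).1 this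
    obtain ⟨v, hv⟩ := h1
    have hc : aeval z (cyclotomic N ℤ) = 0 := by
      apply Subtype.ext
      rw [coe_aeval_Zab, hmin]
      exact minpoly.aeval _ _
    refine ⟨aeval z v, ?_⟩
    rw [sub_eq_iff_eq_add.1 hv]
    simp [hc]
lemma ringHom_aeval {R S σ : Type*} [CommRing R] [CommRing S] [Algebra ℤ R] [Algebra ℤ S]
    (φ : R →+* S) (x : σ → R) (f : MvPolynomial σ ℤ) :
    φ (MvPolynomial.aeval x f) = MvPolynomial.aeval (fun i => φ (x i)) f := by
  induction f using MvPolynomial.induction_on with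
  | C a => simp
  | add f g hf hg => simp [hf, hg]
  | mul_X f i hf => simp [hf]

open Polynomial in
lemma expand_pow_zmod (p : ℕ) [Fact p.Prime] (P : (ZMod p)[X]) (e : ℕ) :
    expand (ZMod p) (p ^ e) P = P ^ (p ^ e) := by
  induction e with
  | zero => simp
  | succ e ih => rw [pow_succ, mul_comm, ← expand_expand, ih, map_pow, ZMod.expand_card, ← pow_mul]

open Polynomial in
lemma exists_psi (p : ℕ) [hp : Fact p.Prime] (P : (ZMod p)[X]) (hP : Irreducible P)
    (K : Type*) [Field K] [Algebra (ZMod p) K] (hd : Module.finrank (ZMod p) K ∣ P.natDegree)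
    (e : ℕ) : ∃ Ψ : K[X] →+* (ZMod p)[X] ⧸ Ideal.span {P ^ e}, ∀ h, Ψ h = 0 ↔ X ^ e ∣ h := by
  have : Fact (Irreducible P) := ⟨hP⟩
  have hfr : Module.finrank (ZMod p) (AdjoinRoot P) = P.natDegree := by
    rw [(AdjoinRoot.powerBasis hP.ne_zero).finrank, AdjoinRoot.powerBasis_dim]
  have : FiniteDimensional (ZMod p) (AdjoinRoot P) := (AdjoinRoot.powerBasis hP.ne_zero).finite
  have : Finite (AdjoinRoot P) := Module.finite_of_finite (ZMod p)
  obtain ⟨σ⟩ := FiniteField.nonempty_algHom_of_finrank_dvd (F := ZMod p) (K := K)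
    (L := AdjoinRoot P) (hfr ▸ hd)
  let q := Ideal.Quotient.mk (Ideal.span {P ^ e})
  have hq : ∀ h, q h = 0 ↔ P ^ e ∣ h := fun h => by
    rw [Ideal.Quotient.eq_zero_iff_mem, Ideal.mem_span_singleton]
  have hev : P.eval₂ (q.comp C) (q (X ^ (p ^ e))) = 0 := by
    have h1 : P.eval₂ (q.comp C) (q (X ^ (p ^ e))) = q (expand (ZMod p) (p ^ e) P) := by
      rw [expand_eq_comp_X_pow, comp, hom_eval₂]
    rw [h1, hq, expand_pow_zmod]
    exact pow_dvd_pow _ (Nat.lt_pow_self hp.out.one_lt).le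
  let lam : AdjoinRoot P →+* (ZMod p)[X] ⧸ Ideal.span {P ^ e} := AdjoinRoot.lift _ _ hev
  let Ψ : K[X] →+* (ZMod p)[X] ⧸ Ideal.span {P ^ e} :=
    eval₂RingHom (lam.comp σ.toRingHom) (q P)
  have hX : Ψ X = q P := by simp [Ψ]
  have hnil : (q P) ^ e = 0 := by rw [← map_pow, hq]
  refine ⟨Ψ, fun h => ⟨fun h0 => ?_, ?_⟩⟩
  · by_cases hh : h = 0
    · simp [hh]
    obtain ⟨g, hg, hgX⟩ := exists_eq_pow_rootMultiplicity_mul_and_not_dvd h hh 0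
    rw [C_0, sub_zero] at hg hgX
    rw [X_dvd_iff] at hgX
    have hu : IsUnit (Ψ g) := by
      rw [← divX_mul_X_add g, map_add, map_mul, hX]
      have h1 : IsUnit (Ψ (C (g.coeff 0))) := (isUnit_C.2 (isUnit_iff_ne_zero.2 hgX)).map Ψ
      have h2 : IsNilpotent (Ψ g.divX * q P) := Commute.isNilpotent_mul_left (Commute.all _ _) ⟨e, hnil⟩
      exact IsNilpotent.isUnit_add_right_of_commute h2 h1 (Commute.all _ _)
    rw [hg, map_mul, map_pow, hX, hu.mul_left_eq_zero, ← map_pow, hq,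
      pow_dvd_pow_iff hP.ne_zero hP.not_isUnit] at h0
    rw [hg]
    exact dvd_mul_of_dvd_left (pow_dvd_pow _ h0) _
  · rintro ⟨g, rfl⟩
    rw [map_mul, map_pow, hX, hnil, zero_mul]

/-- substitution `X ↦ X + α`. -/
def tauMap {F : Type*} [Field F] (α : F) : Polynomial ℤ →+* Polynomial F :=
  Polynomial.eval₂RingHom (Int.castRingHom _) (Polynomial.X + Polynomial.C α)

open Polynomial in
lemma tau_dvd (p : ℕ) [Fact p.Prime] {F : Type*} [Field F] [Algebra (ZMod p) F] (α : F) (e : ℕ)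
    (h : ℤ[X]) : X ^ e ∣ tauMap α h ↔
      (X - C α) ^ e ∣ (h.map (Int.castRingHom (ZMod p))).map (algebraMap (ZMod p) F) := by
  have h1 : tauMap α h = ((h.map (Int.castRingHom (ZMod p))).map (algebraMap (ZMod p) F)).comp
      (X + C α) := by
    rw [map_map, comp, eval₂_map]
    simp only [tauMap, coe_eval₂RingHom]
    congr 1
    exact RingHom.ext_int _ _
  rw [h1, dvd_comp_X_add_C_iff]
  simp

open Polynomial in
lemma exists_alpha (p m e : ℕ) [hp : Fact p.Prime] (hm : ¬ p ∣ m) (G : (ZMod p)[X])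
    (hG : ¬ cyclotomic m (ZMod p) ^ e ∣ G) :
    ∃ α : AlgebraicClosure (ZMod p), 
      (X - C α) ^ e ∣ (cyclotomic m (ZMod p) ^ e).map (algebraMap _ (AlgebraicClosure (ZMod p))) ∧
      ¬ (X - C α) ^ e ∣ G.map (algebraMap _ (AlgebraicClosure (ZMod p))) := by
  set F := AlgebraicClosure (ZMod p)
  have hchar : CharP F p := charP_of_injective_algebraMap (algebraMap (ZMod p) F).injective p
  have hne : NeZero (m : F) := ⟨fun h => hm ((CharP.cast_eq_zero_iff F p m).1 h)⟩
  obtain ⟨ζ, hζ⟩ := HasEnoughRootsOfUnity.exists_primitiveRoot F m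
  have hprod := cyclotomic_eq_prod_X_sub_primitiveRoots hζ
  have hc : (cyclotomic m (ZMod p) ^ e).map (algebraMap _ F) =
      ∏ μ ∈ primitiveRoots m F, (X - C μ) ^ e := by
    rw [Polynomial.map_pow, map_cyclotomic, hprod, Finset.prod_pow]
  by_contra! hcon
  apply hG
  rw [← map_dvd_map' (algebraMap (ZMod p) F), hc]
  refine Finset.prod_dvd_of_coprime ?_ ?_
  · intro a _ b _ hab
    exact (isCoprime_X_sub_C_of_isUnit_sub (isUnit_iff_ne_zero.2 (sub_ne_zero.2 hab))).pow
  · intro a ha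
    refine hcon a ?_
    rw [hc]
    exact Finset.dvd_prod_of_mem (fun μ => (X - C μ) ^ e) ha
open Polynomial in
lemma exists_descent (p : ℕ) [hp : Fact p.Prime] {ι : Type*} [Finite ι]
    (Y : ι → (AlgebraicClosure (ZMod p))[X]) :
    ∃ K : IntermediateField (ZMod p) (AlgebraicClosure (ZMod p)),
      FiniteDimensional (ZMod p) K ∧ ∃ Z : ι → K[X], ∀ i,
        (Z i).map (algebraMap K (AlgebraicClosure (ZMod p))) = Y i := by
  let S : Set (AlgebraicClosure (ZMod p)) := ⋃ i, ((Y i).coeffs : Set _)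
  have hS : S.Finite := Set.finite_iUnion fun i => Finset.finite_toSet _
  have : Finite S := hS
  refine ⟨IntermediateField.adjoin (ZMod p) S,
    IntermediateField.finiteDimensional_adjoin fun x _ => Algebra.IsIntegral.isIntegral x, ?_⟩
  have h : ∀ i, ∃ Z : (IntermediateField.adjoin (ZMod p) S)[X],
      Z.map (algebraMap _ (AlgebraicClosure (ZMod p))) = Y i := by
    intro i
    have : Y i ∈ lifts (algebraMap (IntermediateField.adjoin (ZMod p) S) (AlgebraicClosure (ZMod p))) := by
      rw [lifts_iff_coeff_lifts]
      intro n
      by_cases hn : (Y i).coeff n = 0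
      · exact ⟨0, by simp [hn]⟩
      · exact ⟨⟨(Y i).coeff n, IntermediateField.subset_adjoin _ _
          (Set.mem_iUnion.2 ⟨i, coeff_mem_coeffs hn⟩)⟩, rfl⟩
    exact (mem_lifts _).1 this
  choose Z hZ using h
  exact ⟨Z, hZ⟩

open Polynomial UniqueFactorizationMonoid in
lemma exists_factors (p d n : ℕ) [hp : Fact p.Prime] (hd : 0 < d) :
    ∃ m, ¬ p ∣ m ∧ 0 < m ∧ ∃ S : Finset (ZMod p)[X], n ≤ S.card ∧
      (∀ P ∈ S, Irreducible P ∧ d ∣ P.natDegree) ∧ (∀ P ∈ S, ∀ Q ∈ S, P ≠ Q → IsCoprime P Q) ∧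
      Associated (∏ P ∈ S, P) (cyclotomic m (ZMod p)) := by
  classical
  obtain ⟨r, hr, hdr, hn⟩ := exists_r p d n hp.out hd
  have h1 : 1 < p ^ r := Nat.one_lt_pow (by omega) hp.out.one_lt
  have hpm : ¬ p ∣ p ^ r - 1 := by
    intro h
    have h2 : p ∣ p ^ r := dvd_pow_self p (by omega)
    have := (Nat.dvd_sub_iff_right h1.le h2).1 h
    exact hp.out.one_lt.ne' (Nat.dvd_one.1 this)
  have hcop : p.Coprime (p ^ r - 1) := (Nat.Prime.coprime_iff_not_dvd hp.out).2 hpm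
  have hord := order_r p r hp.out hr (hcop.pow_left 1)
  have hK : Fintype.card (ZMod p) = p ^ 1 := by simp
  have hcard := normalizedFactors_cyclotomic_card hK hcop
  rw [hord] at hcard
  have hNe : NeZero ((p ^ r - 1 : ℕ) : ZMod p) :=
    ⟨fun h => hpm ((CharP.cast_eq_zero_iff (ZMod p) p _).1 h)⟩
  have hsq := squarefree_cyclotomic (p ^ r - 1) (ZMod p)
  have h0 := cyclotomic_ne_zero (p ^ r - 1) (ZMod p)
  refine ⟨p ^ r - 1, hpm, by omega, (normalizedFactors (cyclotomic (p ^ r - 1) (ZMod p))).toFinset,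
    ?_, ?_, ?_, ?_⟩
  · rw [hcard, Nat.le_div_iff_mul_le (by omega)]
    exact hn
  · intro P hP
    rw [Multiset.mem_toFinset] at hP
    refine ⟨irreducible_of_normalized_factor P hP, ?_⟩
    rw [natDegree_of_mem_normalizedFactors_cyclotomic hK hcop hP, hord]
    exact hdr
  · intro P hP Q hQ hPQ
    rw [Multiset.mem_toFinset] at hP hQ
    rw [(irreducible_of_normalized_factor P hP).coprime_iff_not_dvd]
    intro hdvd
    exact hPQ (((irreducible_of_normalized_factor P hP).associated_of_dvd
      (irreducible_of_normalized_factor Q hQ) hdvd).eq_of_normalized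
        (normalize_normalized_factor P hP) (normalize_normalized_factor Q hQ))
  · have hnd := (squarefree_iff_nodup_normalizedFactors h0).1 hsq
    have := prod_normalizedFactors h0
    rw [Finset.prod_eq_multiset_prod, Multiset.toFinset_val, hnd.dedup, Multiset.map_id']
    exact this

lemma dir1 (p : ℕ) [hp : Fact p.Prime] (m n : ℕ)
    (f g : Fin n → MvPolynomial (Fin m) ℤ) (x : Fin m → ZabMod p) (hx : ∀ i : Fin n,
        MvPolynomial.aeval x (f i) = 0 ∧ MvPolynomial.aeval x (g i) ≠ 0) :
    (∃ x : Fin m → (ℕ → PerfQuot (AlgebraicClosure (ZMod p)) p), ∀ i : Fin n,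
        MvPolynomial.aeval x (f i) = 0 ∧ MvPolynomial.aeval x (g i) ≠ 0) := by
  rcases Nat.eq_zero_or_pos n with rfl | hn
  · exact ⟨0, fun i => i.elim0⟩
  obtain ⟨M, k, hM, z, hz, Y, hY⟩ := xi_lift p hp.out x
  have hN : 0 < p ^ (k + 1) * M := Nat.mul_pos (pow_pos hp.out.pos _)
    (Nat.pos_of_ne_zero (by rintro rfl; simp at hM))
  have hcy : Polynomial.cyclotomic (p ^ (k + 1) * M) (ZMod p) =
      Polynomial.cyclotomic M (ZMod p) ^ (p ^ k * (p - 1)) := by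
    rw [Polynomial.cyclotomic_mul_prime_pow_eq _ hM (Nat.succ_pos k), Nat.succ_sub_one, pow_succ,
      Nat.mul_sub, mul_one]
  have key : ∀ F : MvPolynomial (Fin m) ℤ, MvPolynomial.aeval x F = 0 ↔
      Polynomial.cyclotomic M (ZMod p) ^ (p ^ k * (p - 1)) ∣
        (MvPolynomial.aeval Y F).map (Int.castRingHom (ZMod p)) := by
    intro F
    rw [← hcy, ← xi_eq_zero p _ hN z hz, ringHom_aeval]
    simp only [hY]
  have hg := fun i => mt (key (g i)).2 (hx i).2
  choose α hα1 hα2 using fun i => exists_alpha p M _ hM _ (hg i)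
  let c : ℕ → Fin n := fun l => if h : l < n then ⟨l, h⟩ else ⟨0, hn⟩
  have key2 : ∀ (l : ℕ) (F : MvPolynomial (Fin m) ℤ), MvPolynomial.aeval
      (fun j => thetaMap (AlgebraicClosure (ZMod p)) p k (tauMap (α (c l)) (Y j))) F = 0 ↔
      (Polynomial.X - Polynomial.C (α (c l))) ^ (p ^ k * (p - 1)) ∣
        ((MvPolynomial.aeval Y F).map (Int.castRingHom (ZMod p))).map
          (algebraMap (ZMod p) (AlgebraicClosure (ZMod p))) := by
    intro l F
    rw [← tau_dvd, ← theta_eq_zero _ _ _ hp.out, ringHom_aeval, ringHom_aeval]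
  let X : Fin m → (ℕ → PerfQuot (AlgebraicClosure (ZMod p)) p) :=
    fun j l => thetaMap (AlgebraicClosure (ZMod p)) p k (tauMap (α (c l)) (Y j))
  have key3 : ∀ (F : MvPolynomial (Fin m) ℤ) (l : ℕ), MvPolynomial.aeval X F l = MvPolynomial.aeval
      (fun j => thetaMap (AlgebraicClosure (ZMod p)) p k (tauMap (α (c l)) (Y j))) F := by
    intro F l
    exact ringHom_aeval (Pi.evalRingHom _ l) X F
  refine ⟨X, fun i => ⟨?_, fun h0 => ?_⟩⟩
  · funext l
    rw [key3, Pi.zero_apply, key2]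
    refine (hα1 (c l)).trans ?_
    exact Polynomial.map_dvd _ ((key (f i)).1 (hx i).1)
  · have h1 := congrFun h0 i
    rw [key3, Pi.zero_apply, key2] at h1
    have hc : c i = i := by simp [c]
    rw [hc] at h1
    exact hα2 i h1

open Polynomial in
lemma dir2 (p : ℕ) [hp : Fact p.Prime] (m n : ℕ)
    (f g : Fin n → MvPolynomial (Fin m) ℤ)
    (x : Fin m → (ℕ → PerfQuot (AlgebraicClosure (ZMod p)) p)) (hx : ∀ i : Fin n,
        MvPolynomial.aeval x (f i) = 0 ∧ MvPolynomial.aeval x (g i) ≠ 0) :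
    (∃ x : Fin m → ZabMod p, ∀ i : Fin n,
        MvPolynomial.aeval x (f i) = 0 ∧ MvPolynomial.aeval x (g i) ≠ 0) := by
  rcases Nat.eq_zero_or_pos n with rfl | hn
  · exact ⟨0, fun i => i.elim0⟩
  have key3 : ∀ (F : MvPolynomial (Fin m) ℤ) (l : ℕ), MvPolynomial.aeval x F l = MvPolynomial.aeval (fun j => x j l) F := by
    intro F l
    exact ringHom_aeval (Pi.evalRingHom _ l) x F
  have hl : ∀ i, ∃ l, MvPolynomial.aeval (fun j => x j l) (g i) ≠ 0 := by
    intro i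
    by_contra! hcon
    refine (hx i).2 (funext fun l => ?_)
    rw [key3, hcon l, Pi.zero_apply]
  choose l hl using hl
  have hf : ∀ i i', MvPolynomial.aeval (fun j => x j (l i)) (f i') = 0 := by
    intro i i'
    rw [← key3, (hx i').1, Pi.zero_apply]
  obtain ⟨k, Y, hY⟩ := theta_lift (AlgebraicClosure (ZMod p)) p
    (fun a : Fin n × Fin m => x a.2 (l a.1))
  obtain ⟨K, hK, Z, hZ⟩ := exists_descent p Y
  have key : ∀ (i : Fin n) (F : MvPolynomial (Fin m) ℤ), MvPolynomial.aeval (fun j => x j (l i)) F = 0 ↔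
      X ^ (p ^ k * (p - 1)) ∣ MvPolynomial.aeval (fun j => Z (i, j)) F := by
    intro i F
    have h1 : MvPolynomial.aeval (fun j => x j (l i)) F = thetaMap (AlgebraicClosure (ZMod p)) p k
        (mapRingHom (algebraMap K (AlgebraicClosure (ZMod p)))
          (MvPolynomial.aeval (fun j => Z (i, j)) F)) := by
      rw [ringHom_aeval, ringHom_aeval]
      simp only [coe_mapRingHom, hZ, hY]
    rw [h1, theta_eq_zero _ _ _ hp.out, X_pow_dvd_iff, X_pow_dvd_iff]
    simp only [coe_mapRingHom, coeff_map, map_eq_zero]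
  obtain ⟨M, hM, hM0, S, hS, hirr, hcop, hass⟩ :=
    exists_factors p (Module.finrank (ZMod p) K) n Module.finrank_pos
  generalize he : p ^ k * (p - 1) = e at *
  have hψ : ∀ P : S, ∃ Ψ : K[X] →+* (ZMod p)[X] ⧸ Ideal.span {(P : (ZMod p)[X]) ^ e},
      ∀ h, Ψ h = 0 ↔ X ^ e ∣ h :=
    fun P => exists_psi p P (hirr P P.2).1 K (hirr P P.2).2 e
  choose Ψ hΨ using hψ
  obtain ⟨emb⟩ : Nonempty (Fin n ↪ S) := by
    apply Function.Embedding.nonempty_of_card_le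
    simpa using hS
  have : Nonempty (Fin n) := ⟨⟨0, hn⟩⟩
  let c : S → Fin n := Function.invFun emb
  have hc : ∀ i, c (emb i) = i := Function.leftInverse_invFun emb.injective
  have hW : ∀ j : Fin m, ∃ W : ℤ[X], ∀ P : S,
      Ideal.Quotient.mk (Ideal.span {(P : (ZMod p)[X]) ^ e}) (W.map (Int.castRingHom (ZMod p)))
        = Ψ P (Z (c P, j)) := by
    intro j
    choose w hw using fun P : S => Ideal.Quotient.mk_surjective (Ψ P (Z (c P, j)))
    obtain ⟨W, hW⟩ := Ideal.exists_forall_sub_mem_ideal (I := fun P : S => Ideal.span {(P : (ZMod p)[X]) ^ e}) (by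
        intro P Q hPQ
        rw [Function.onFun, Ideal.isCoprime_span_singleton_iff]
        exact (hcop P P.2 Q Q.2 (fun h => hPQ (Subtype.ext h))).pow) w
    obtain ⟨W, rfl⟩ := map_surjective (Int.castRingHom (ZMod p)) (ZMod.intCast_surjective) W
    refine ⟨W, fun P => ?_⟩
    rw [← hw P, Ideal.Quotient.eq]
    exact hW P
  choose W hW using hW
  have hN : 0 < p ^ (k + 1) * M := Nat.mul_pos (pow_pos hp.out.pos _) hM0
  obtain ⟨z, hz⟩ := exists_prim _ hN
  have hcy : cyclotomic (p ^ (k + 1) * M) (ZMod p) = cyclotomic M (ZMod p) ^ e := by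
    rw [cyclotomic_mul_prime_pow_eq _ hM (Nat.succ_pos k), Nat.succ_sub_one, pow_succ, ← he,
      Nat.mul_sub, mul_one]
  have key4 : ∀ (F : MvPolynomial (Fin m) ℤ), MvPolynomial.aeval (fun j => xiMap p z (W j)) F = 0 ↔
      cyclotomic M (ZMod p) ^ e ∣ (MvPolynomial.aeval W F).map (Int.castRingHom (ZMod p)) := by
    intro F
    rw [← hcy, ← xi_eq_zero p _ hN z hz, ringHom_aeval]
  have key5 : ∀ (P : S) (F : MvPolynomial (Fin m) ℤ), (P : (ZMod p)[X]) ^ e ∣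
      (MvPolynomial.aeval W F).map (Int.castRingHom (ZMod p)) ↔
      MvPolynomial.aeval (fun j => x j (l (c P))) F = 0 := by
    intro P F
    rw [key, ← hΨ P, ringHom_aeval, ← Ideal.mem_span_singleton, ← Ideal.Quotient.eq_zero_iff_mem,
      ← coe_mapRingHom, ringHom_aeval, ringHom_aeval]
    simp only [coe_mapRingHom, hW]
  refine ⟨fun j => xiMap p z (W j), fun i => ⟨?_, ?_⟩⟩
  · rw [key4, ← (hass.pow_pow (n := e)).dvd_iff_dvd_left, ← Finset.prod_pow]
    refine Finset.prod_dvd_of_coprime ?_ ?_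
    · intro P hP Q hQ hPQ
      exact (hcop P hP Q hQ hPQ).pow
    · intro P hP
      exact (key5 ⟨P, hP⟩ (f i)).2 (hf _ _)
  · rw [Ne, key4]
    intro hd
    have h1 : ((emb i : S) : (ZMod p)[X]) ^ e ∣ cyclotomic M (ZMod p) ^ e :=
      pow_dvd_pow_of_dvd ((Finset.dvd_prod_of_mem (fun P => P) (emb i).2).trans hass.dvd) e
    have h2 := (key5 (emb i) (g i)).1 (h1.trans hd)
    rw [hc] at h2
    exact hl i h2

/-- Fix a prime `p` and let `A_p = 𝔽̄_p[t^{1/p^∞}]/(t^{p-1})`. The rings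
`ℤ^ab/pℤ^ab` and the countable power `(A_p)^ℕ` are existentially equivalent in the
language of rings: every finite system of integer polynomial equations and inequations is
solvable in one iff it is solvable in the other. -/
theorem stmt4 (p : ℕ) [hp : Fact p.Prime] (m n : ℕ)
    (f g : Fin n → MvPolynomial (Fin m) ℤ) :
    (∃ x : Fin m → ZabMod p, ∀ i : Fin n,
        MvPolynomial.aeval x (f i) = 0 ∧ MvPolynomial.aeval x (g i) ≠ 0) ↔
    (∃ x : Fin m → (ℕ → PerfQuot (AlgebraicClosure (ZMod p)) p), ∀ i : Fin n,
        MvPolynomial.aeval x (f i) = 0 ∧ MvPolynomial.aeval x (g i) ≠ 0) :=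
  ⟨fun ⟨x, hx⟩ => dir1 p m n f g x hx, fun ⟨x, hx⟩ => dir2 p m n f g x hx⟩

end
end
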